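/- (Theorem 3, region inclusion) For every discrete memoryless broadcast channel with generalized feedback, R_inner* ⊆ R_inner. -/

import Mathlib

open scoped BigOperators Classical

noncomputable section

namespace BCFB

variable {Ω A B C : Type*}

/-- Probability of an event under a weight function on a finite sample space. -/
def prOf [Fintype Ω] (w : Ω → ℝ) (E : Ω → Prop) : ℝ :=
  ∑ ω, if E ω then w ω else 0

/-- Distribution (pushforward) of a random variable. -/
def distOf [Fintype Ω] (w : Ω → ℝ) (X : Ω → A) : A → ℝ :=
  fun a => prOf w fun ω => X ω = a

/-- Shannon entropy (base 2) of a random variable. -/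
def entOf [Fintype Ω] [Fintype A] (w : Ω → ℝ) (X : Ω → A) : ℝ :=
  -∑ a, distOf w X a * Real.logb 2 (distOf w X a)

/-- Mutual information (base 2). -/
def miOf [Fintype Ω] [Fintype A] [Fintype B] (w : Ω → ℝ) (X : Ω → A) (Y : Ω → B) : ℝ :=
  entOf w X + entOf w Y - entOf w fun ω => (X ω, Y ω)

/-- Conditional mutual information I(X;Y|Z) (base 2). -/
def cmiOf [Fintype Ω] [Fintype A] [Fintype B] [Fintype C]
    (w : Ω → ℝ) (X : Ω → A) (Y : Ω → B) (Z : Ω → C) : ℝ :=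
  entOf w (fun ω => (X ω, Z ω)) + entOf w (fun ω => (Y ω, Z ω))
    - entOf w (fun ω => (X ω, Y ω, Z ω)) - entOf w Z

/-- `w` is a probability mass function. -/
def IsPMF [Fintype Ω] (w : Ω → ℝ) : Prop := (∀ ω, 0 ≤ w ω) ∧ ∑ ω, w ω = 1

/-- `k` is a transition kernel (each row a pmf). -/
def IsKernel {A B : Type*} [Fintype A] [Fintype B] (k : A → B → ℝ) : Prop :=
  ∀ a, IsPMF (k a)

/-- `X — Y — Z` forms a Markov chain (i.e. `X` and `Z` are conditionally
independent given `Y`). -/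
def MarkovChain [Fintype Ω] (w : Ω → ℝ) (X : Ω → A) (Y : Ω → B) (Z : Ω → C) : Prop :=
  ∀ a b c,
    distOf w (fun ω => (X ω, Y ω, Z ω)) (a, b, c) * distOf w Y b
      = distOf w (fun ω => (X ω, Y ω)) (a, b) * distOf w (fun ω => (Z ω, Y ω)) (c, b)

/-- `X` and `Y` are independent. -/
def IndepRV [Fintype Ω] (w : Ω → ℝ) (X : Ω → A) (Y : Ω → B) : Prop :=
  ∀ a b, distOf w (fun ω => (X ω, Y ω)) (a, b) = distOf w X a * distOf w Y b

/-- Number of messages of rate `R` and blocklength `n`: `⌊2^{nR}⌋`. -/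
def msgCard (n : ℕ) (R : ℝ) : ℕ := ⌊(2 : ℝ) ^ ((n : ℝ) * R)⌋₊

/-- Binary entropy function. -/
def hb (u : ℝ) : ℝ := -(u * Real.logb 2 u) - (1 - u) * Real.logb 2 (1 - u)

/-- Empirical frequency of the letter `a` in the sequence `x`. -/
def freqOf {A : Type*} {n : ℕ} (x : Fin n → A) (a : A) : ℝ :=
  ((Finset.univ.filter fun t => x t = a).card : ℝ) / n

/-- `ε`-typicality of a sequence w.r.t. a pmf `P`. -/
def Typical {A : Type*} (ε : ℝ) {n : ℕ} (P : A → ℝ) (x : Fin n → A) : Prop :=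
  ∀ a, |freqOf x a - P a| ≤ ε * P a

section NoFB

variable {X Y1 Y2 : Type*} [Fintype X] [Fintype Y1] [Fintype Y2]

/-- Error probability of a blocklength-`n` no-feedback code over the DMBC `W`. -/
def errProbNoFB (W : X → Y1 × Y2 → ℝ) (n : ℕ) (R0 R1 R2 : ℝ)
    (enc : Fin (msgCard n R0) × Fin (msgCard n R1) × Fin (msgCard n R2) → Fin n → X)
    (dec1 : (Fin n → Y1) → Fin (msgCard n R0) × Fin (msgCard n R1))
    (dec2 : (Fin n → Y2) → Fin (msgCard n R0) × Fin (msgCard n R2)) : ℝ :=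
  (1 / ((msgCard n R0 : ℝ) * (msgCard n R1 : ℝ) * (msgCard n R2 : ℝ))) *
    ∑ m : Fin (msgCard n R0) × Fin (msgCard n R1) × Fin (msgCard n R2),
      ∑ y : Fin n → Y1 × Y2,
        (∏ t, W (enc m t) (y t)) *
          (if dec1 (fun t => (y t).1) ≠ (m.1, m.2.1) ∨ dec2 (fun t => (y t).2) ≠ (m.1, m.2.2)
            then 1 else 0)

/-- Achievability of a rate triple over the DMBC `W` without feedback. -/
def AchievableNoFB (W : X → Y1 × Y2 → ℝ) (R0 R1 R2 : ℝ) : Prop :=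
  0 ≤ R0 ∧ 0 ≤ R1 ∧ 0 ≤ R2 ∧
    ∃ enc : (n : ℕ) →
        Fin (msgCard n R0) × Fin (msgCard n R1) × Fin (msgCard n R2) → Fin n → X,
    ∃ dec1 : (n : ℕ) → (Fin n → Y1) → Fin (msgCard n R0) × Fin (msgCard n R1),
    ∃ dec2 : (n : ℕ) → (Fin n → Y2) → Fin (msgCard n R0) × Fin (msgCard n R2),
      Filter.Tendsto (fun n => errProbNoFB W n R0 R1 R2 (enc n) (dec1 n) (dec2 n))
        Filter.atTop (nhds 0)

/-- The no-feedback capacity region. -/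
def CNoFB (W : X → Y1 × Y2 → ℝ) : Set (ℝ × ℝ × ℝ) :=
  closure {r | AchievableNoFB W r.1 r.2.1 r.2.2}

end NoFB

section FB

variable {X Y1 Y2 Yt : Type*} [Fintype X] [Fintype Y1] [Fintype Y2] [Fintype Yt]

/-- Causality: the time-`t` channel input depends only on feedback symbols before time `t`. -/
def Causal {X Yt : Type*} (n : ℕ) {M : Type*} (enc : Fin n → M → (Fin n → Yt) → X) : Prop :=
  ∀ (t : Fin n) (m : M) (fb fb' : Fin n → Yt),
    (∀ s : Fin n, (s : ℕ) < (t : ℕ) → fb s = fb' s) → enc t m fb = enc t m fb'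

/-- Error probability of a blocklength-`n` feedback code over the DMBC with
generalized feedback `W`. -/
def errProbFB (W : X → Y1 × Y2 × Yt → ℝ) (n : ℕ) (R0 R1 R2 : ℝ)
    (enc : Fin n → Fin (msgCard n R0) × Fin (msgCard n R1) × Fin (msgCard n R2) →
      (Fin n → Yt) → X)
    (dec1 : (Fin n → Y1) → Fin (msgCard n R0) × Fin (msgCard n R1))
    (dec2 : (Fin n → Y2) → Fin (msgCard n R0) × Fin (msgCard n R2)) : ℝ :=
  (1 / ((msgCard n R0 : ℝ) * (msgCard n R1 : ℝ) * (msgCard n R2 : ℝ))) *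
    ∑ m : Fin (msgCard n R0) × Fin (msgCard n R1) × Fin (msgCard n R2),
      ∑ y : Fin n → Y1 × Y2 × Yt,
        (∏ t, W (enc t m fun s => (y s).2.2) (y t)) *
          (if dec1 (fun t => (y t).1) ≠ (m.1, m.2.1) ∨
              dec2 (fun t => (y t).2.1) ≠ (m.1, m.2.2)
            then 1 else 0)

/-- Achievability of a rate triple over the DMBC with generalized feedback `W`. -/
def AchievableFB (W : X → Y1 × Y2 × Yt → ℝ) (R0 R1 R2 : ℝ) : Prop :=
  0 ≤ R0 ∧ 0 ≤ R1 ∧ 0 ≤ R2 ∧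
    ∃ enc : (n : ℕ) → Fin n →
        Fin (msgCard n R0) × Fin (msgCard n R1) × Fin (msgCard n R2) → (Fin n → Yt) → X,
    ∃ dec1 : (n : ℕ) → (Fin n → Y1) → Fin (msgCard n R0) × Fin (msgCard n R1),
    ∃ dec2 : (n : ℕ) → (Fin n → Y2) → Fin (msgCard n R0) × Fin (msgCard n R2),
      (∀ n, Causal n (enc n)) ∧
      Filter.Tendsto (fun n => errProbFB W n R0 R1 R2 (enc n) (dec1 n) (dec2 n))
        Filter.atTop (nhds 0)

/-- Capacity region of the DMBC with generalized feedback `W`. -/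
def CGenFB (W : X → Y1 × Y2 × Yt → ℝ) : Set (ℝ × ℝ × ℝ) :=
  closure {r | AchievableFB W r.1 r.2.1 r.2.2}

end FB

/-- Extension of a DMBC to a generalized-feedback channel with noiseless feedback
`Ỹ = (Y₁, Y₂)`. -/
def noiselessExt {X Y1 Y2 : Type*} (W : X → Y1 × Y2 → ℝ) :
    X → Y1 × Y2 × (Y1 × Y2) → ℝ :=
  fun x y => if y.2.2 = (y.1, y.2.1) then W x (y.1, y.2.1) else 0

/-- Capacity region of a DMBC with noiseless feedback. -/
def CNoiselessFB {X Y1 Y2 : Type*} [Fintype X] [Fintype Y1] [Fintype Y2]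
    (W : X → Y1 × Y2 → ℝ) : Set (ℝ × ℝ × ℝ) :=
  CGenFB (noiselessExt W)

section Marton

variable {X Y1 Y2 : Type*} [Fintype X] [Fintype Y1] [Fintype Y2]

/-- The single-letter Marton constraints for the rate triple `(R0,R1,R2)`. -/
def MartonCond (W : X → Y1 × Y2 → ℝ) (R0 R1 R2 : ℝ) : Prop :=
  ∃ (k0 k1 k2 : ℕ) (p : Fin k0 × Fin k1 × Fin k2 → ℝ)
    (f : Fin k0 × Fin k1 × Fin k2 → X), IsPMF p ∧
    (let w : (Fin k0 × Fin k1 × Fin k2) × Y1 × Y2 → ℝ := fun z => p z.1 * W (f z.1) z.2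
     let U0 := fun z : (Fin k0 × Fin k1 × Fin k2) × Y1 × Y2 => z.1.1
     let U1 := fun z : (Fin k0 × Fin k1 × Fin k2) × Y1 × Y2 => z.1.2.1
     let U2 := fun z : (Fin k0 × Fin k1 × Fin k2) × Y1 × Y2 => z.1.2.2
     let Yr1 := fun z : (Fin k0 × Fin k1 × Fin k2) × Y1 × Y2 => z.2.1
     let Yr2 := fun z : (Fin k0 × Fin k1 × Fin k2) × Y1 × Y2 => z.2.2
     R0 < min (miOf w U0 Yr1) (miOf w U0 Yr2) ∧
     R0 + R1 < miOf w (fun z => (U0 z, U1 z)) Yr1 ∧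
     R0 + R2 < miOf w (fun z => (U0 z, U2 z)) Yr2 ∧
     R0 + R1 + R2 < cmiOf w U1 Yr1 U0 + cmiOf w U2 Yr2 U0
       + min (miOf w U0 Yr1) (miOf w U0 Yr2) - cmiOf w U1 U2 U0)

/-- Marton's achievable region for the DMBC `W` without feedback. -/
def MartonRegion (W : X → Y1 × Y2 → ℝ) : Set (ℝ × ℝ × ℝ) :=
  closure {r | 0 ≤ r.1 ∧ 0 ≤ r.2.1 ∧ 0 ≤ r.2.2 ∧ MartonCond W r.1 r.2.1 r.2.2}

end Marton

end BCFB
namespace BCFB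

section Inner

variable {X Y1 Y2 Yt : Type*} [Fintype X] [Fintype Y1] [Fintype Y2] [Fintype Yt]

/-- Single-letter constraints defining `R_inner` for the DMBC with generalized feedback. -/
def InnerCond (W : X → Y1 × Y2 × Yt → ℝ) (R0 R1 R2 : ℝ) : Prop :=
  ∃ (k0 k1 k2 l0 l1 l2 : ℕ)
    (p : Fin k0 × Fin k1 × Fin k2 → ℝ)
    (f : Fin k0 × Fin k1 × Fin k2 → X)
    (PV : (Fin k0 × Fin k1 × Fin k2) × Yt → Fin l0 × Fin l1 × Fin l2 → ℝ),
    IsPMF p ∧ IsKernel PV ∧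
    (let w : (Fin k0 × Fin k1 × Fin k2) × (Y1 × Y2 × Yt) × (Fin l0 × Fin l1 × Fin l2) → ℝ :=
       fun z => p z.1 * W (f z.1) z.2.1 * PV (z.1, z.2.1.2.2) z.2.2
     -- I(U₀,U₁;Y₁,V₁) and I(U₀,U₂;Y₂,V₂)
     let A1 := miOf w (fun z => (z.1.1, z.1.2.1)) (fun z => (z.2.1.1, z.2.2.2.1))
     let A2 := miOf w (fun z => (z.1.1, z.1.2.2)) (fun z => (z.2.1.2.1, z.2.2.2.2))
     -- I(U₀,U₁,U₂,Ỹ;V₀,V₁|Y₁) and I(U₀,U₁,U₂,Ỹ;V₀,V₂|Y₂)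
     let B1 := cmiOf w (fun z => (z.1, z.2.1.2.2)) (fun z => (z.2.2.1, z.2.2.2.1))
       (fun z => z.2.1.1)
     let B2 := cmiOf w (fun z => (z.1, z.2.1.2.2)) (fun z => (z.2.2.1, z.2.2.2.2))
       (fun z => z.2.1.2.1)
     -- I(U₁;Y₁,V₁|U₀) and I(U₂;Y₂,V₂|U₀)
     let C1 := cmiOf w (fun z => z.1.2.1) (fun z => (z.2.1.1, z.2.2.2.1)) (fun z => z.1.1)
     let C2 := cmiOf w (fun z => z.1.2.2) (fun z => (z.2.1.2.1, z.2.2.2.2)) (fun z => z.1.1)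
     -- min_i I(U₀;Y_i,V_i)
     let D := min (miOf w (fun z => z.1.1) (fun z => (z.2.1.1, z.2.2.2.1)))
       (miOf w (fun z => z.1.1) (fun z => (z.2.1.2.1, z.2.2.2.2)))
     -- I(U₁;U₂|U₀)
     let E := cmiOf w (fun z => z.1.2.1) (fun z => z.1.2.2) (fun z => z.1.1)
     -- I(U₀,U₁,U₂,Ỹ;V₁|V₀,Y₁) and I(U₀,U₁,U₂,Ỹ;V₂|V₀,Y₂)
     let F1 := cmiOf w (fun z => (z.1, z.2.1.2.2)) (fun z => z.2.2.2.1)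
       (fun z => (z.2.2.1, z.2.1.1))
     let F2 := cmiOf w (fun z => (z.1, z.2.1.2.2)) (fun z => z.2.2.2.2)
       (fun z => (z.2.2.1, z.2.1.2.1))
     -- max_i I(U₀,U₁,U₂,Ỹ;V₀|Y_i)
     let G := max (cmiOf w (fun z => (z.1, z.2.1.2.2)) (fun z => z.2.2.1) (fun z => z.2.1.1))
       (cmiOf w (fun z => (z.1, z.2.1.2.2)) (fun z => z.2.2.1) (fun z => z.2.1.2.1))
     R0 + R1 ≤ A1 - B1 ∧
     R0 + R2 ≤ A2 - B2 ∧
     R0 + R1 + R2 ≤ C1 + C2 + D - E - F1 - F2 - G ∧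
     2 * R0 + R1 + R2 ≤ C1 + C2 + 2 * D - E - F1 - F2)

/-- The region `R_inner`: closed convex hull of the triples satisfying `InnerCond`. -/
def InnerRegion (W : X → Y1 × Y2 × Yt → ℝ) : Set (ℝ × ℝ × ℝ) :=
  closure (convexHull ℝ
    {r | 0 ≤ r.1 ∧ 0 ≤ r.2.1 ∧ 0 ≤ r.2.2 ∧ InnerCond W r.1 r.2.1 r.2.2})

/-- Single-letter constraints defining `R_inner*` for the DMBC with generalized feedback. -/
def InnerStarCond (W : X → Y1 × Y2 × Yt → ℝ) (R0 R1 R2 : ℝ) : Prop :=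
  ∃ (k0 k1 k2 l0 l1 l2 : ℕ)
    (p : Fin k0 × Fin k1 × Fin k2 → ℝ)
    (f : Fin k0 × Fin k1 × Fin k2 → X)
    (PV : X × Yt → Fin l0 × Fin l1 × Fin l2 → ℝ),
    IsPMF p ∧ IsKernel PV ∧
    (let w : (Fin k0 × Fin k1 × Fin k2) × (Y1 × Y2 × Yt) × (Fin l0 × Fin l1 × Fin l2) → ℝ :=
       fun z => p z.1 * W (f z.1) z.2.1 * PV (f z.1, z.2.1.2.2) z.2.2
     -- I(U₀,U₁;Y₁,V₁) and I(U₀,U₂;Y₂,V₂)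
     let A1 := miOf w (fun z => (z.1.1, z.1.2.1)) (fun z => (z.2.1.1, z.2.2.2.1))
     let A2 := miOf w (fun z => (z.1.1, z.1.2.2)) (fun z => (z.2.1.2.1, z.2.2.2.2))
     -- I(U₁;Y₁,V₁|U₀) and I(U₂;Y₂,V₂|U₀)
     let C1 := cmiOf w (fun z => z.1.2.1) (fun z => (z.2.1.1, z.2.2.2.1)) (fun z => z.1.1)
     let C2 := cmiOf w (fun z => z.1.2.2) (fun z => (z.2.1.2.1, z.2.2.2.2)) (fun z => z.1.1)
     -- min_i I(U₀;Y_i,V_i)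
     let D := min (miOf w (fun z => z.1.1) (fun z => (z.2.1.1, z.2.2.2.1)))
       (miOf w (fun z => z.1.1) (fun z => (z.2.1.2.1, z.2.2.2.2)))
     -- I(U₁;U₂|U₀)
     let E := cmiOf w (fun z => z.1.2.1) (fun z => z.1.2.2) (fun z => z.1.1)
     -- I(X,Ỹ;V₁|V₀,Y₁) and I(X,Ỹ;V₂|V₀,Y₂)
     let F1 := cmiOf w (fun z => (f z.1, z.2.1.2.2)) (fun z => z.2.2.2.1)
       (fun z => (z.2.2.1, z.2.1.1))
     let F2 := cmiOf w (fun z => (f z.1, z.2.1.2.2)) (fun z => z.2.2.2.2)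
       (fun z => (z.2.2.1, z.2.1.2.1))
     -- max_i I(V₀;X,Ỹ|Y_i)
     let G := max (cmiOf w (fun z => z.2.2.1) (fun z => (f z.1, z.2.1.2.2)) (fun z => z.2.1.1))
       (cmiOf w (fun z => z.2.2.1) (fun z => (f z.1, z.2.1.2.2)) (fun z => z.2.1.2.1))
     R0 ≤ D - G ∧
     R0 + R1 ≤ A1 - F1 - G ∧
     R0 + R2 ≤ A2 - F2 - G ∧
     R0 + R1 + R2 ≤ C1 + C2 + D - E - F1 - F2 - G)

/-- The region `R_inner*`: closed convex hull of the triples satisfying `InnerStarCond`. -/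
def InnerStarRegion (W : X → Y1 × Y2 × Yt → ℝ) : Set (ℝ × ℝ × ℝ) :=
  closure (convexHull ℝ
    {r | 0 ≤ r.1 ∧ 0 ≤ r.2.1 ∧ 0 ≤ r.2.2 ∧ InnerStarCond W r.1 r.2.1 r.2.2})

end Inner

end BCFB

namespace BCFB

section Entropy

variable {Ω A B C : Type*} [Fintype Ω] [Fintype A] [Fintype B] [Fintype C]

lemma sum_mul_comp_eq_sum_distOf (w : Ω → ℝ) (X : Ω → A) (F : A → ℝ) :
    ∑ ω, w ω * F (X ω) = ∑ a, distOf w X a * F a := by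
  simp only [distOf, prOf, Finset.sum_mul, ite_mul, zero_mul]
  rw [Finset.sum_comm]
  simp

lemma entOf_eq_sum (w : Ω → ℝ) (X : Ω → A) :
    entOf w X = -∑ ω, w ω * Real.logb 2 (distOf w X (X ω)) := by
  rw [sum_mul_comp_eq_sum_distOf w X fun a => Real.logb 2 (distOf w X a)]
  rfl

/-- Entropy depends only on the partition of the sample space induced by the random variable. -/
lemma entOf_congr (w : Ω → ℝ) {X : Ω → A} {Y : Ω → B}
    (h : ∀ ω ω', X ω = X ω' ↔ Y ω = Y ω') : entOf w X = entOf w Y := by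
  simp only [entOf_eq_sum, distOf, h]

lemma distOf_nonneg {w : Ω → ℝ} (hw : ∀ ω, 0 ≤ w ω) {A : Type*} (X : Ω → A) (a : A) :
    0 ≤ distOf w X a :=
  Finset.sum_nonneg fun ω _ => by split_ifs <;> simp [hw]

lemma distOf_pos {w : Ω → ℝ} (hw : ∀ ω, 0 ≤ w ω) {A : Type*} (X : Ω → A) {ω : Ω}
    (h : 0 < w ω) : 0 < distOf w X (X ω) :=
  Finset.sum_pos' (fun ω' _ => by split_ifs <;> simp [hw])
    ⟨ω, Finset.mem_univ _, by simpa using h⟩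

lemma sum_distOf_prod (w : Ω → ℝ) (X : Ω → A) {C : Type*} (Z : Ω → C) (c : C) :
    ∑ a, distOf w (fun ω => (X ω, Z ω)) (a, c) = distOf w Z c := by
  simp only [distOf, prOf]
  rw [Finset.sum_comm]
  refine Finset.sum_congr rfl fun ω _ => ?_
  by_cases h : Z ω = c <;> simp [h]

lemma sum_distOf (w : Ω → ℝ) (X : Ω → A) : ∑ a, distOf w X a = ∑ ω, w ω := by
  simpa using (sum_mul_comp_eq_sum_distOf w X fun _ => 1).symm

lemma sum_mul_ratio_le {w : Ω → ℝ} (hw : ∀ ω, 0 ≤ w ω) (X : Ω → A) (Y : Ω → B) (Z : Ω → C) :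
    ∑ ω, w ω * (distOf w (fun ω => (X ω, Z ω)) (X ω, Z ω)
        * distOf w (fun ω => (Y ω, Z ω)) (Y ω, Z ω)
        / (distOf w (fun ω => (X ω, Y ω, Z ω)) (X ω, Y ω, Z ω) * distOf w Z (Z ω)))
      ≤ ∑ ω, w ω := by
  rw [sum_mul_comp_eq_sum_distOf w (fun ω => (X ω, Y ω, Z ω)) fun t =>
    distOf w (fun ω => (X ω, Z ω)) (t.1, t.2.2) * distOf w (fun ω => (Y ω, Z ω)) (t.2.1, t.2.2)
      / (distOf w (fun ω => (X ω, Y ω, Z ω)) t * distOf w Z t.2.2)]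
  calc _ ≤ ∑ t : A × B × C, distOf w (fun ω => (X ω, Z ω)) (t.1, t.2.2)
        * distOf w (fun ω => (Y ω, Z ω)) (t.2.1, t.2.2) / distOf w Z t.2.2 := by
        refine Finset.sum_le_sum fun t _ => ?_
        rcases eq_or_ne (distOf w (fun ω => (X ω, Y ω, Z ω)) t) 0 with h | h
        · rw [h, zero_mul]
          exact div_nonneg (mul_nonneg (distOf_nonneg hw _ _) (distOf_nonneg hw _ _))
            (distOf_nonneg hw _ _)
        · rw [← mul_div_assoc, mul_div_mul_left _ _ h]
    _ = ∑ c, distOf w Z c := by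
        simp only [Fintype.sum_prod_type]
        rw [Finset.sum_congr rfl fun a _ => Finset.sum_comm, Finset.sum_comm]
        refine Finset.sum_congr rfl fun c _ => ?_
        simp only [← Finset.sum_div, ← Finset.mul_sum, ← Finset.sum_mul, sum_distOf_prod]
        exact mul_self_div_self _
    _ = _ := sum_distOf w Z

lemma cmiOf_nonneg {w : Ω → ℝ} (hw : ∀ ω, 0 ≤ w ω) (X : Ω → A) (Y : Ω → B) (Z : Ω → C) :
    0 ≤ cmiOf w X Y Z := by
  have hlog : 0 < Real.log 2 := Real.log_pos one_lt_two
  have key : ∑ ω, w ω * (1 - distOf w (fun ω => (X ω, Z ω)) (X ω, Z ω)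
        * distOf w (fun ω => (Y ω, Z ω)) (Y ω, Z ω)
        / (distOf w (fun ω => (X ω, Y ω, Z ω)) (X ω, Y ω, Z ω) * distOf w Z (Z ω)))
      ≤ cmiOf w X Y Z * Real.log 2 := by
    simp only [cmiOf, entOf_eq_sum, ← Finset.sum_neg_distrib, ← Finset.sum_add_distrib,
      ← Finset.sum_sub_distrib, Finset.sum_mul]
    refine Finset.sum_le_sum fun ω _ => ?_
    rcases (hw ω).eq_or_lt with h | h
    · simp [← h]
    have hX := distOf_pos hw (fun ω => (X ω, Z ω)) h
    have hY := distOf_pos hw (fun ω => (Y ω, Z ω)) h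
    have hXY := distOf_pos hw (fun ω => (X ω, Y ω, Z ω)) h
    have hZ := distOf_pos hw Z h
    have hle := mul_le_mul_of_nonneg_left
      (Real.log_le_sub_one_of_pos (div_pos (mul_pos hX hY) (mul_pos hXY hZ))) h.le
    rw [Real.log_div (mul_pos hX hY).ne' (mul_pos hXY hZ).ne', Real.log_mul hX.ne' hY.ne',
      Real.log_mul hXY.ne' hZ.ne'] at hle
    refine le_of_le_of_eq (neg_le_neg hle |>.trans_eq' (by ring)) ?_
    simp only [Real.logb]
    field_simp
    ring
  have := sum_mul_ratio_le hw X Y Z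
  simp only [mul_sub, mul_one, Finset.sum_sub_distrib] at key
  exact nonneg_of_mul_nonneg_left (by linarith) hlog

end Entropy

section Kernel

variable {A B V T D E : Type*} [Fintype A] [Fintype B] [Fintype V]

/-- `H(φ(V)|T)` for `V` generated from `T = τ(a, b)` by the kernel `k`. -/
def kernelEntropy (q : A → B → ℝ) (τ : A → B → T) (k : T → V → ℝ) (φ : V → E) : ℝ :=
  -∑ z : A × B × V, q z.1 z.2.1 * k (τ z.1 z.2.1) z.2.2
    * Real.logb 2 (distOf (k (τ z.1 z.2.1)) φ (φ z.2.2))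

lemma distOf_kernel (q : A → B → ℝ) (τ : A → B → T) {k : T → V → ℝ}
    (hk : ∀ t, ∑ v, k t v = 1) (φ : V → E) (R : A → B → D)
    (hR : ∀ a b a' b', R a b = R a' b' → τ a b = τ a' b') (a : A) (b : B) (e : E) :
    distOf (fun z : A × B × V => q z.1 z.2.1 * k (τ z.1 z.2.1) z.2.2)
        (fun z => (R z.1 z.2.1, φ z.2.2)) (R a b, e)
      = distOf (fun z : A × B × V => q z.1 z.2.1 * k (τ z.1 z.2.1) z.2.2)
          (fun z => R z.1 z.2.1) (R a b) * distOf (k (τ a b)) φ e := by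
  simp only [distOf, prOf, Fintype.sum_prod_type]
  rw [Finset.sum_mul]
  refine Finset.sum_congr rfl fun a' _ => ?_
  rw [Finset.sum_mul]
  refine Finset.sum_congr rfl fun b' _ => ?_
  by_cases h : R a' b' = R a b
  · simp only [h, Prod.mk.injEq, true_and, if_true, hR _ _ _ _ h, ← Finset.mul_sum, hk, mul_one]
    simp [Finset.mul_sum]
  · simp [h]

lemma entOf_kernel [Fintype D] [Fintype E] {q : A → B → ℝ} (hq : ∀ a b, 0 ≤ q a b) (τ : A → B → T) {k : T → V → ℝ}
    (hk : ∀ t, IsPMF (k t)) (φ : V → E) (R : A → B → D)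
    (hR : ∀ a b a' b', R a b = R a' b' → τ a b = τ a' b') :
    entOf (fun z : A × B × V => q z.1 z.2.1 * k (τ z.1 z.2.1) z.2.2)
        (fun z => (R z.1 z.2.1, φ z.2.2))
      = entOf (fun z : A × B × V => q z.1 z.2.1 * k (τ z.1 z.2.1) z.2.2)
          (fun z => R z.1 z.2.1) + kernelEntropy q τ k φ := by
  have hw : ∀ z : A × B × V, 0 ≤ q z.1 z.2.1 * k (τ z.1 z.2.1) z.2.2 :=
    fun z => mul_nonneg (hq _ _) ((hk _).1 _)
  rw [entOf_eq_sum, entOf_eq_sum, kernelEntropy, ← neg_add, ← Finset.sum_add_distrib, neg_inj]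
  refine Finset.sum_congr rfl fun z _ => ?_
  rcases (hw z).eq_or_lt with h | h
  · simp [← h]
  have h1 := distOf_pos hw (fun z => (R z.1 z.2.1, φ z.2.2)) h
  have h2 := distOf_kernel q τ (fun t => (hk t).2) φ R hR z.1 z.2.1 (φ z.2.2)
  rw [h2] at h1 ⊢
  rw [Real.logb_mul (left_ne_zero_of_mul h1.ne') (right_ne_zero_of_mul h1.ne'), mul_add]

end Kernel

end BCFB
namespace BCFB

section Markov

variable {A B V T Y S V0 V1 : Type*} [Fintype A] [Fintype B] [Fintype V] [Fintype Y]
  [Fintype S] [Fintype V0] [Fintype V1]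

/-- If `S` determines `T` and `V` is generated from `T`, then
`I(S;φ(V)|Y) = H(φ(V)|Y) - H(φ(V)|T)`. -/
lemma cmiOf_kernel {q : A → B → ℝ} (hq : ∀ a b, 0 ≤ q a b) (τ : A → B → T) {k : T → V → ℝ}
    (hk : ∀ t, IsPMF (k t)) (φ : V → V0) (s : A → B → S) (y : B → Y)
    (hs : ∀ a b a' b', s a b = s a' b' → τ a b = τ a' b') :
    let w := fun z : A × B × V => q z.1 z.2.1 * k (τ z.1 z.2.1) z.2.2
    cmiOf w (fun z => s z.1 z.2.1) (fun z => φ z.2.2) (fun z => y z.2.1)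
      = entOf w (fun z => (φ z.2.2, y z.2.1)) - entOf w (fun z => y z.2.1)
        - kernelEntropy q τ k φ := by
  intro w
  have h := entOf_kernel hq τ hk φ (fun a b => (s a b, y b))
    fun a b a' b' h => hs _ _ _ _ (Prod.ext_iff.1 h).1
  have h' : entOf w (fun z => (s z.1 z.2.1, φ z.2.2, y z.2.1))
      = entOf w (fun z => ((s z.1 z.2.1, y z.2.1), φ z.2.2)) :=
    entOf_congr w fun _ _ => by simp only [Prod.mk.injEq]; tauto
  rw [cmiOf, h', h]
  ring

/-- If `S` determines `T` and `V` is generated from `T`, then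
`I(S;V₁|V₀,Y) = H(V₁|V₀,Y) - (H(V₀,V₁|T) - H(V₀|T))`. -/
lemma cmiOf_kernel_cond {q : A → B → ℝ} (hq : ∀ a b, 0 ≤ q a b) (τ : A → B → T) {k : T → V → ℝ}
    (hk : ∀ t, IsPMF (k t)) (φ0 : V → V0) (φ1 : V → V1) (s : A → B → S) (y : B → Y)
    (hs : ∀ a b a' b', s a b = s a' b' → τ a b = τ a' b') :
    let w := fun z : A × B × V => q z.1 z.2.1 * k (τ z.1 z.2.1) z.2.2
    cmiOf w (fun z => s z.1 z.2.1) (fun z => φ1 z.2.2) (fun z => (φ0 z.2.2, y z.2.1))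
      = entOf w (fun z => ((φ0 z.2.2, φ1 z.2.2), y z.2.1))
        - entOf w (fun z => (φ0 z.2.2, y z.2.1))
        - (kernelEntropy q τ k (fun v => (φ0 v, φ1 v)) - kernelEntropy q τ k φ0) := by
  intro w
  have hR : ∀ a b a' b', (s a b, y b) = (s a' b', y b') → τ a b = τ a' b' :=
    fun a b a' b' h => hs _ _ _ _ (Prod.ext_iff.1 h).1
  have h0 := entOf_kernel hq τ hk φ0 (fun a b => (s a b, y b)) hR
  have h1 := entOf_kernel hq τ hk (fun v => (φ0 v, φ1 v)) (fun a b => (s a b, y b)) hR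
  have e0 : entOf w (fun z => (s z.1 z.2.1, φ0 z.2.2, y z.2.1))
      = entOf w (fun z => ((s z.1 z.2.1, y z.2.1), φ0 z.2.2)) :=
    entOf_congr w fun _ _ => by simp only [Prod.mk.injEq]; tauto
  have e1 : entOf w (fun z => (s z.1 z.2.1, φ1 z.2.2, φ0 z.2.2, y z.2.1))
      = entOf w (fun z => ((s z.1 z.2.1, y z.2.1), φ0 z.2.2, φ1 z.2.2)) :=
    entOf_congr w fun _ _ => by simp only [Prod.mk.injEq]; tauto
  have e2 : entOf w (fun z => (φ1 z.2.2, φ0 z.2.2, y z.2.1))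
      = entOf w (fun z => ((φ0 z.2.2, φ1 z.2.2), y z.2.1)) :=
    entOf_congr w fun _ _ => by simp only [Prod.mk.injEq]; tauto
  rw [cmiOf, e0, e1, e2, h0, h1]
  ring

lemma cmiOf_comm {Ω A B C : Type*} [Fintype Ω] [Fintype A] [Fintype B] [Fintype C]
    (w : Ω → ℝ) (X : Ω → A) (Y : Ω → B) (Z : Ω → C) : cmiOf w X Y Z = cmiOf w Y X Z := by
  have h : entOf w (fun ω => (X ω, Y ω, Z ω)) = entOf w (fun ω => (Y ω, X ω, Z ω)) :=
    entOf_congr w fun _ _ => by simp only [Prod.mk.injEq]; tauto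
  rw [cmiOf, cmiOf, h]
  ring

end Markov

lemma InnerStarCond.innerCond {X Y1 Y2 Yt : Type*} [Fintype X] [Fintype Y1] [Fintype Y2]
    [Fintype Yt] {W : X → Y1 × Y2 × Yt → ℝ} (hW : IsKernel W) {R0 R1 R2 : ℝ}
    (h : InnerStarCond W R0 R1 R2) : InnerCond W R0 R1 R2 := by
  obtain ⟨k0, k1, k2, l0, l1, l2, p, f, PV, hp, hPV, h⟩ := h
  refine ⟨k0, k1, k2, l0, l1, l2, p, f, fun s => PV (f s.1, s.2), hp, fun s => hPV _, ?_⟩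
  let q : Fin k0 × Fin k1 × Fin k2 → Y1 × Y2 × Yt → ℝ := fun u y => p u * W (f u) y
  let τ : Fin k0 × Fin k1 × Fin k2 → Y1 × Y2 × Yt → X × Yt := fun u y => (f u, y.2.2)
  let s : Fin k0 × Fin k1 × Fin k2 → Y1 × Y2 × Yt → (Fin k0 × Fin k1 × Fin k2) × Yt :=
    fun u y => (u, y.2.2)
  have hq : ∀ u y, 0 ≤ q u y := fun u y => mul_nonneg (hp.1 _) ((hW _).1 _)
  have hs : ∀ u y u' y', s u y = s u' y' → τ u y = τ u' y' := by
    intro u y u' y' h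
    simp only [s, τ, Prod.mk.injEq] at h ⊢
    exact ⟨congrArg f h.1, h.2⟩
  have hτ : ∀ u y u' y', τ u y = τ u' y' → τ u y = τ u' y' := fun _ _ _ _ h => h
  have hw : ∀ z : (Fin k0 × Fin k1 × Fin k2) × (Y1 × Y2 × Yt) × (Fin l0 × Fin l1 × Fin l2),
      0 ≤ p z.1 * W (f z.1) z.2.1 * PV (f z.1, z.2.1.2.2) z.2.2 :=
    fun z => mul_nonneg (hq _ _) ((hPV _).1 _)
  have g1 := cmiOf_kernel hq τ hPV (fun v => v.1) s (fun y => y.1) hs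
  have g1' := cmiOf_kernel hq τ hPV (fun v => v.1) τ (fun y => y.1) hτ
  have g2 := cmiOf_kernel hq τ hPV (fun v => v.1) s (fun y => y.2.1) hs
  have g2' := cmiOf_kernel hq τ hPV (fun v => v.1) τ (fun y => y.2.1) hτ
  have b1 := cmiOf_kernel hq τ hPV (fun v => (v.1, v.2.1)) s (fun y => y.1) hs
  have b2 := cmiOf_kernel hq τ hPV (fun v => (v.1, v.2.2)) s (fun y => y.2.1) hs
  have f1 := cmiOf_kernel_cond hq τ hPV (fun v => v.1) (fun v => v.2.1) s (fun y => y.1) hs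
  have f1' := cmiOf_kernel_cond hq τ hPV (fun v => v.1) (fun v => v.2.1) τ (fun y => y.1) hτ
  have f2 := cmiOf_kernel_cond hq τ hPV (fun v => v.1) (fun v => v.2.2) s (fun y => y.2.1) hs
  have f2' := cmiOf_kernel_cond hq τ hPV (fun v => v.1) (fun v => v.2.2) τ (fun y => y.2.1) hτ
  have n1 := cmiOf_nonneg hw (fun z => z.2.2.1) (fun z => (f z.1, z.2.1.2.2)) (fun z => z.2.1.1)
  intro w
  dsimp only [q, τ, s] at g1 g1' g2 g2' b1 b2 f1 f1' f2 f2' h n1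
  dsimp only [w]
  rw [cmiOf_comm] at g1' g2'
  rw [g1', g2', f1', f2'] at h
  rw [g1'] at n1
  rw [g1, g2, b1, b2, f1, f2]
  obtain ⟨c0, c1, c2, c3⟩ := h
  refine ⟨c1.trans ?_, c2.trans ?_, c3, ?_⟩
  · grw [← le_max_left]
    linarith
  · grw [← le_max_right]
    linarith
  · linarith [c0.trans (sub_le_self _ (le_max_of_le_left n1)),
      c3.trans (sub_le_self _ (le_max_of_le_left n1))]

/-- **Theorem 3 (region inclusion).** `R_inner* ⊆ R_inner`. -/
theorem innerStarRegion_subset_innerRegion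
    {X Y1 Y2 Yt : Type*} [Fintype X] [Fintype Y1] [Fintype Y2] [Fintype Yt]
    (W : X → Y1 × Y2 × Yt → ℝ) (hW : IsKernel W) :
    InnerStarRegion W ⊆ InnerRegion W := by
  exact closure_mono (convexHull_mono fun _ h => ⟨h.1, h.2.1, h.2.2.1, h.2.2.2.innerCond hW⟩)

end BCFB
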